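/- There is a constant C depending only on α, β, n, j such that for every nonnegative measurable f on (0,∞) and every t ∈ (0,∞): (R_β ∘ H_α^{j+1} ∘ P) f(t) ≤ C·[(R_β ∘ R_α^{j+1}) f(2t) + (H_α^{j+1} ∘ H_β ∘ P) f(t/2)]. -/

import Mathlib

open MeasureTheory Set Real
open scoped ENNReal

noncomputable def phi (n : ℕ) (γ : ℝ) (t : ℝ) : ℝ := min (t ^ (-1 + γ / n)) t⁻¹

noncomputable def Pop (f : ℝ → ℝ≥0∞) (t : ℝ) : ℝ≥0∞ :=
  (∫⁻ s in Set.Ioo (0 : ℝ) t, f s) / ENNReal.ofReal t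

noncomputable def Rop (n : ℕ) (γ : ℝ) (f : ℝ → ℝ≥0∞) (t : ℝ) : ℝ≥0∞ :=
  ENNReal.ofReal (phi n γ t) * ∫⁻ s in Set.Ioo (0 : ℝ) t, f s

noncomputable def Hop (n : ℕ) (γ : ℝ) (f : ℝ → ℝ≥0∞) (t : ℝ) : ℝ≥0∞ :=
  ∫⁻ s in Set.Ioi t, f s * ENNReal.ofReal (phi n γ s)

noncomputable def wt (n : ℕ) (γ : ℝ) (s : ℝ) : ℝ≥0∞ := ENNReal.ofReal (min (s ^ (γ / n)) 1)

noncomputable def FF (f : ℝ → ℝ≥0∞) (t : ℝ) : ℝ≥0∞ := ∫⁻ s in Set.Ioo (0 : ℝ) t, f s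

lemma wt_ne_top (n : ℕ) (γ s : ℝ) : wt n γ s ≠ ∞ := ENNReal.ofReal_ne_top

lemma wt_meas (n : ℕ) (γ : ℝ) : Measurable (wt n γ) := by
  unfold wt
  fun_prop

lemma phi_eq (n : ℕ) (γ s : ℝ) (hs : 0 < s) :
    ENNReal.ofReal (phi n γ s) = wt n γ s * ENNReal.ofReal s⁻¹ := by
  unfold wt phi
  rw [← ENNReal.ofReal_mul (by positivity), min_mul_of_nonneg _ _ (by positivity),
    Real.rpow_add hs, Real.rpow_neg_one, one_mul, mul_comm]

lemma phi_meas (n : ℕ) (γ : ℝ) : Measurable (fun s => ENNReal.ofReal (phi n γ s)) := by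
  unfold phi
  fun_prop

lemma wt_mono (n : ℕ) (γ : ℝ) (hγ : 0 ≤ γ) {a b : ℝ} (ha : 0 < a) (hab : a ≤ b) :
    wt n γ a ≤ wt n γ b := by
  unfold wt
  have : 0 ≤ γ / n := by positivity
  gcongr

lemma wt_scale (n : ℕ) (γ : ℝ) (hγ : 0 ≤ γ) (hγn : γ < n) {l s : ℝ} (hl : 0 < l) (hl1 : l ≤ 1)
    (hs : 0 < s) : ENNReal.ofReal l * wt n γ s ≤ wt n γ (l * s) := by
  unfold wt
  rw [← ENNReal.ofReal_mul hl.le]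
  apply ENNReal.ofReal_le_ofReal
  have hn : (0:ℝ) < n := lt_of_le_of_lt hγ hγn
  have h1 : γ / n ≤ 1 := by rw [div_le_one hn]; exact hγn.le
  have h2 : l ≤ l ^ (γ / n) := by
    calc l = l ^ (1:ℝ) := (Real.rpow_one l).symm
      _ ≤ _ := Real.rpow_le_rpow_of_exponent_ge hl hl1 h1
  rw [mul_min_of_nonneg _ _ hl.le, Real.mul_rpow hl.le hs.le]
  apply min_le_min
  · gcongr
  · simpa using hl1

lemma FF_mono (f : ℝ → ℝ≥0∞) : Monotone (FF f) := fun a b hab =>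
  lintegral_mono_set (Ioo_subset_Ioo_right hab)

lemma Pop_eq (f : ℝ → ℝ≥0∞) {s : ℝ} (hs : 0 < s) : Pop f s = FF f s * ENNReal.ofReal s⁻¹ := by
  unfold Pop FF
  rw [ENNReal.ofReal_inv_of_pos hs, div_eq_mul_inv]

lemma Pop_meas (f : ℝ → ℝ≥0∞) : Measurable (Pop f) := by
  have : Measurable (fun s => FF f s / ENNReal.ofReal s) :=
    (FF_mono f).measurable.div (by fun_prop)
  exact this

lemma Hop_anti (n : ℕ) (γ : ℝ) (f : ℝ → ℝ≥0∞) : Antitone (Hop n γ f) := fun a b hab =>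
  lintegral_mono_set (Ioi_subset_Ioi hab)

lemma Hop_iter_meas (n : ℕ) (γ : ℝ) (f : ℝ → ℝ≥0∞) (hf : Measurable f) (k : ℕ) :
    Measurable ((Hop n γ)^[k] f) := by
  cases k with
  | zero => exact hf
  | succ k =>
    rw [Function.iterate_succ_apply']
    exact (Hop_anti n γ _).measurable

lemma ofReal_inv_cancel {s : ℝ} (hs : 0 < s) : ENNReal.ofReal s⁻¹ * ENNReal.ofReal s = 1 := by
  rw [← ENNReal.ofReal_mul (by positivity), inv_mul_cancel₀ hs.ne', ENNReal.ofReal_one]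

lemma fub (n : ℕ) (γ : ℝ) (hγ : 0 ≤ γ) (h : ℝ → ℝ≥0∞) (hh : Measurable h) (m : ℕ) (t : ℝ) :
    ∫⁻ s in Ioo 0 t, wt n γ s ^ m * Hop n γ h s ≤
      (∫⁻ s in Ioo 0 t, wt n γ s ^ (m + 1) * h s)
        + ENNReal.ofReal t * wt n γ t ^ m * Hop n γ h t := by
  set p : ℝ → ℝ≥0∞ := fun s => ENNReal.ofReal (phi n γ s) with hp
  have hpm : Measurable p := phi_meas n γ
  have hwm : Measurable (wt n γ) := wt_meas n γ
  have hint : ∀ u, ∫⁻ s in Ioo 0 u, wt n γ s ^ m ≤ ENNReal.ofReal u * wt n γ u ^ m := by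
    intro u
    calc ∫⁻ s in Ioo 0 u, wt n γ s ^ m ≤ ∫⁻ s in Ioo 0 u, wt n γ u ^ m := by
          apply setLIntegral_mono' measurableSet_Ioo
          intro s hs
          have := wt_mono n γ hγ hs.1 hs.2.le
          gcongr
      _ = _ := by simp [mul_comm]
  have hsplit : ∀ s ∈ Ioo 0 t, wt n γ s ^ m * Hop n γ h s ≤
      (∫⁻ u in Ioo 0 t, (Ioi s).indicator (fun u => wt n γ s ^ m * (h u * p u)) u)
        + wt n γ s ^ m * Hop n γ h t := by
    intro s hs
    have h1 : Hop n γ h s ≤ (∫⁻ u in Ioo s t, h u * p u) + Hop n γ h t := by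
      unfold Hop
      rw [← Ioc_union_Ioi_eq_Ioi hs.2.le, setLIntegral_congr (Ioo_ae_eq_Ioc (μ := volume))]
      exact lintegral_union_le _ _ _
    have h2 : wt n γ s ^ m * ∫⁻ u in Ioo s t, h u * p u =
      (∫⁻ u in Ioo 0 t, (Ioi s).indicator (fun u => wt n γ s ^ m * (h u * p u)) u) := by
      rw [lintegral_indicator measurableSet_Ioi, Measure.restrict_restrict measurableSet_Ioi,
        ← lintegral_const_mul _ (by fun_prop)]
      congr 2
      ext u
      simp only [mem_inter_iff, mem_Ioo, mem_Ioi]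
      constructor
      · rintro ⟨a, b⟩; exact ⟨a, hs.1.trans a, b⟩
      · rintro ⟨a, b, c⟩; exact ⟨a, c⟩
    rw [← h2, ← mul_add]
    gcongr
  calc _ ≤ ∫⁻ s in Ioo 0 t, ((∫⁻ u in Ioo 0 t,
            (Ioi s).indicator (fun u => wt n γ s ^ m * (h u * p u)) u)
        + wt n γ s ^ m * Hop n γ h t) := setLIntegral_mono' measurableSet_Ioo hsplit
    _ = (∫⁻ s in Ioo 0 t, ∫⁻ u in Ioo 0 t,
            (Ioi s).indicator (fun u => wt n γ s ^ m * (h u * p u)) u)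
        + ∫⁻ s in Ioo 0 t, wt n γ s ^ m * Hop n γ h t := by
          rw [lintegral_add_right _ (by fun_prop)]
    _ ≤ _ := by
      refine add_le_add ?_ ?_
      · rw [lintegral_lintegral_swap]
        · apply setLIntegral_mono' measurableSet_Ioo
          intro u hu
          calc ∫⁻ s in Ioo 0 t, (Ioi s).indicator (fun u => wt n γ s ^ m * (h u * p u)) u
            = ∫⁻ s in Ioo 0 t, (Iio u).indicator (fun s => wt n γ s ^ m * (h u * p u)) s := by
                apply lintegral_congr
                intro s
                simp [indicator]
            _ = ∫⁻ s in Ioo 0 u, wt n γ s ^ m * (h u * p u) := by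
                rw [lintegral_indicator measurableSet_Iio,
                  Measure.restrict_restrict measurableSet_Iio]
                congr 2
                ext s
                simp only [mem_inter_iff, mem_Ioo, mem_Iio]
                constructor
                · rintro ⟨a, b, c⟩; exact ⟨b, a⟩
                · rintro ⟨a, b⟩; exact ⟨b, a, b.trans hu.2⟩
            _ = (∫⁻ s in Ioo 0 u, wt n γ s ^ m) * (h u * p u) := by
                rw [lintegral_mul_const _ (by fun_prop)]
            _ ≤ (ENNReal.ofReal u * wt n γ u ^ m) * (h u * p u) := by
                gcongr
                exact hint u
            _ = (ENNReal.ofReal u⁻¹ * ENNReal.ofReal u) * (wt n γ u ^ (m+1) * h u) := by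
                simp only [hp]
                rw [phi_eq n γ u hu.1]
                ring
            _ = _ := by rw [ofReal_inv_cancel hu.1, one_mul]
        · have : (Function.uncurry fun s u =>
              (Ioi s).indicator (fun u => wt n γ s ^ m * (h u * p u)) u) =
              {q : ℝ × ℝ | q.1 < q.2}.indicator
                (fun q => wt n γ q.1 ^ m * (h q.2 * p q.2)) := by
            ext ⟨a, b⟩
            simp [Function.uncurry, indicator]
          rw [this]
          apply Measurable.aemeasurable
          apply Measurable.indicator
          · fun_prop
          · exact measurableSet_lt measurable_fst measurable_snd
      · rw [lintegral_mul_const _ (by fun_prop)]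
        gcongr
        exact hint t

lemma absorb (n : ℕ) (α γ : ℝ) (hγ : 0 ≤ γ) (f : ℝ → ℝ≥0∞) (k : ℕ) :
    ∀ t : ℝ, 0 < t → wt n γ t * (Hop n α)^[k] (Pop f) t ≤
      4 * (Hop n α)^[k] (Hop n γ (Pop f)) t := by
  induction k with
  | zero =>
    intro t ht
    simp only [Function.iterate_zero, id]
    have h1 : ∫⁻ u in Ioo t (2*t), (FF f t * ENNReal.ofReal (2*t)⁻¹) *
        (wt n γ t * ENNReal.ofReal (2*t)⁻¹) ≤ Hop n γ (Pop f) t := by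
      unfold Hop
      calc _ ≤ ∫⁻ u in Ioo t (2*t), Pop f u * ENNReal.ofReal (phi n γ u) := by
            apply setLIntegral_mono' measurableSet_Ioo
            intro u hu
            have hu0 : 0 < u := ht.trans hu.1
            rw [Pop_eq f hu0, phi_eq n γ u hu0]
            have := wt_mono n γ hγ ht hu.1.le
            have := FF_mono f hu.1.le
            have := hu.2.le
            gcongr
        _ ≤ _ := lintegral_mono_set Ioo_subset_Ioi_self
    calc wt n γ t * Pop f t = 4 * ((FF f t * ENNReal.ofReal (2*t)⁻¹) *
        (wt n γ t * ENNReal.ofReal (2*t)⁻¹) * ENNReal.ofReal t) := by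
          rw [Pop_eq f ht]
          have : ENNReal.ofReal t⁻¹ = 4 * (ENNReal.ofReal (2*t)⁻¹ * ENNReal.ofReal (2*t)⁻¹
            * ENNReal.ofReal t) := by
            rw [← ENNReal.ofReal_mul (by positivity), ← ENNReal.ofReal_mul (by positivity),
              show (4:ℝ≥0∞) = ENNReal.ofReal 4 by simp, ← ENNReal.ofReal_mul (by positivity)]
            congr 1
            field_simp
            norm_num
          rw [this]
          ring
      _ ≤ _ := by
        gcongr
        refine le_trans (le_of_eq ?_) h1
        rw [setLIntegral_const, Real.volume_Ioo]
        congr 2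
        ring
  | succ k ih =>
    intro t ht
    rw [Function.iterate_succ_apply', Function.iterate_succ_apply']
    change wt n γ t * (∫⁻ u in Ioi t, (Hop n α)^[k] (Pop f) u * ENNReal.ofReal (phi n α u)) ≤
      4 * (∫⁻ u in Ioi t, (Hop n α)^[k] (Hop n γ (Pop f)) u * ENNReal.ofReal (phi n α u))
    rw [← lintegral_const_mul' _ _ (wt_ne_top n γ t), ← lintegral_const_mul' _ _ (by simp)]
    apply setLIntegral_mono' measurableSet_Ioi
    intro u hu
    rw [← mul_assoc, ← mul_assoc]
    refine mul_le_mul_left (le_trans ?_ (ih u (ht.trans hu))) _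
    exact mul_le_mul_left (wt_mono n γ hγ ht (le_of_lt hu)) _

lemma iter (n : ℕ) (α : ℝ) (hα : 0 ≤ α) (k : ℕ) :
    ∃ C : NNReal, ∀ (f : ℝ → ℝ≥0∞) (m : ℕ) (t : ℝ), 0 < t →
    ∫⁻ s in Ioo 0 t, wt n α s ^ m * (Hop n α)^[k] (Pop f) s ≤
      (∫⁻ s in Ioo 0 t, wt n α s ^ (m + k) * Pop f s)
        + C * (ENNReal.ofReal t * wt n α t ^ m * (Hop n α)^[k] (Pop f) t) := by
  induction k with
  | zero => exact ⟨0, fun f m t ht => by simp⟩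
  | succ k ih =>
    obtain ⟨C, hC⟩ := ih
    refine ⟨C * 4 + 1, fun f m t ht => ?_⟩
    have h1 := fub n α hα _ (Hop_iter_meas n α (Pop f) (Pop_meas f) k) m t
    have h2 := hC f (m+1) t ht
    have h3 := absorb n α α hα f k t ht
    rw [← Function.iterate_succ_apply] at h3
    rw [← Function.iterate_succ_apply' (Hop n α)] at h1
    refine h1.trans ((add_le_add_left h2 _).trans ?_)
    rw [show m + 1 + k = m + (k+1) by ring, add_assoc]
    gcongr
    calc _ = C * (ENNReal.ofReal t * wt n α t ^ m * (wt n α t * (Hop n α)^[k] (Pop f) t))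
          + ENNReal.ofReal t * wt n α t ^ m * (Hop n α)^[k+1] (Pop f) t := by ring
      _ ≤ C * (ENNReal.ofReal t * wt n α t ^ m * (4 * (Hop n α)^[k+1] (Pop f) t))
          + ENNReal.ofReal t * wt n α t ^ m * (Hop n α)^[k+1] (Pop f) t := by gcongr
      _ = _ := by push_cast; ring

lemma Rlow (n : ℕ) (α : ℝ) (hα : 0 ≤ α) (hαn : α < n) (k : ℕ) :
    ∀ σ : ℝ, 0 < σ → σ < 1 → ∃ C : NNReal, ∀ (f : ℝ → ℝ≥0∞) (s : ℝ), 0 < s →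
      wt n α s ^ (k+1) * FF f (σ * s) * ENNReal.ofReal s⁻¹ ≤ C * (Rop n α)^[k+1] f s := by
  induction k with
  | zero =>
    intro σ h0 h1
    refine ⟨1, fun f s hs => ?_⟩
    simp only [zero_add, Function.iterate_one, pow_one, ENNReal.coe_one, one_mul]
    unfold Rop
    rw [phi_eq n α s hs]
    have : FF f (σ * s) ≤ FF f s := FF_mono f (by nlinarith)
    calc _ ≤ wt n α s * FF f s * ENNReal.ofReal s⁻¹ := by gcongr
      _ = _ := by unfold FF; ring
  | succ k ih =>
    intro σ h0 h1
    set ρ := √σ with hρ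
    have hρ0 : 0 < ρ := Real.sqrt_pos.2 h0
    have hρ1 : ρ < 1 := by rw [hρ, Real.sqrt_lt' one_pos]; simpa using h1
    have hρρ : ρ * ρ = σ := Real.mul_self_sqrt h0.le
    obtain ⟨C, hC⟩ := ih ρ hρ0 hρ1
    refine ⟨C * Real.toNNReal (ρ⁻¹ ^ (k+1) * (1-ρ)⁻¹), fun f s hs => ?_⟩
    have hρs : 0 < ρ * s := by positivity
    have key : ENNReal.ofReal ρ ^ (k+1) * wt n α s ^ (k+1) * FF f (σ * s) * ENNReal.ofReal s⁻¹
        * ENNReal.ofReal ((1 - ρ) * s) ≤ C * ∫⁻ u in Ioo 0 s, (Rop n α)^[k+1] f u := by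
      rw [← lintegral_const_mul' _ _ (by simp)]
      calc _ = ∫⁻ u in Ioo (ρ * s) s, ENNReal.ofReal ρ ^ (k+1) * wt n α s ^ (k+1)
                * FF f (σ * s) * ENNReal.ofReal s⁻¹ := by
            rw [setLIntegral_const, Real.volume_Ioo]
            congr 2
            ring
        _ ≤ ∫⁻ u in Ioo (ρ * s) s, C * (Rop n α)^[k+1] f u := by
            apply setLIntegral_mono' measurableSet_Ioo
            intro u hu
            have hu0 : 0 < u := hρs.trans hu.1
            refine le_trans ?_ (hC f u hu0)
            rw [← mul_pow]
            have a1 := (wt_scale n α hα hαn hρ0 hρ1.le hs).trans (wt_mono n α hα hρs hu.1.le)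
            have a2 : FF f (σ * s) ≤ FF f (ρ * u) := FF_mono f (by
              rw [← hρρ, mul_assoc]; exact mul_le_mul_of_nonneg_left hu.1.le hρ0.le)
            have := hu.2.le
            gcongr
        _ ≤ _ := lintegral_mono_set (Ioo_subset_Ioo_left hρs.le)
    rw [Function.iterate_succ_apply']
    conv_rhs => unfold Rop
    rw [phi_eq n α s hs]
    change _ ≤ _ * (_ * ∫⁻ u in Ioo 0 s, (Rop n α)^[k+1] f u)
    set I := ∫⁻ u in Ioo 0 s, (Rop n α)^[k+1] f u
    have hone : ENNReal.ofReal (ρ⁻¹ ^ (k+1) * (1-ρ)⁻¹) * ENNReal.ofReal ρ ^ (k+1)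
        * ENNReal.ofReal ((1 - ρ) * s) * ENNReal.ofReal s⁻¹ = 1 := by
      have : 0 < 1 - ρ := by linarith
      rw [← ENNReal.ofReal_pow hρ0.le, ← ENNReal.ofReal_mul (by positivity),
        ← ENNReal.ofReal_mul (by positivity), ← ENNReal.ofReal_mul (by positivity)]
      rw [← ENNReal.ofReal_one]
      congr 1
      field_simp
      rw [← mul_pow, one_div, inv_mul_cancel₀ hρ0.ne', one_pow]
    calc wt n α s ^ (k+1+1) * FF f (σ * s) * ENNReal.ofReal s⁻¹
        = (ENNReal.ofReal (ρ⁻¹ ^ (k+1) * (1-ρ)⁻¹) * ENNReal.ofReal ρ ^ (k+1)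
        * ENNReal.ofReal ((1 - ρ) * s) * ENNReal.ofReal s⁻¹) *
          (wt n α s ^ (k+1+1) * FF f (σ * s) * ENNReal.ofReal s⁻¹) := by rw [hone, one_mul]
      _ = ENNReal.ofReal (ρ⁻¹ ^ (k+1) * (1-ρ)⁻¹) * (wt n α s * ENNReal.ofReal s⁻¹) *
          (ENNReal.ofReal ρ ^ (k+1) * wt n α s ^ (k+1) * FF f (σ * s) * ENNReal.ofReal s⁻¹
        * ENNReal.ofReal ((1 - ρ) * s)) := by ring
      _ ≤ ENNReal.ofReal (ρ⁻¹ ^ (k+1) * (1-ρ)⁻¹) * (wt n α s * ENNReal.ofReal s⁻¹) *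
          (C * I) := by gcongr
      _ = _ := by
        rw [ENNReal.coe_mul]
        change ENNReal.ofReal _ * _ * _ = C * ENNReal.ofReal _ * _
        ring

lemma lint_scale (g : ℝ → ℝ≥0∞) (t : ℝ) :
    ∫⁻ u in Ioo 0 t, 2 * g (2 * u) = ∫⁻ u in Ioo 0 (2 * t), g u := by
  have h := lintegral_image_eq_lintegral_abs_deriv_mul (s := Ioo 0 t) (f := fun x => 2 * x)
    (f' := fun _ => 2) measurableSet_Ioo
    (fun x _ => by simpa using ((hasDerivAt_id x).const_mul (2:ℝ)).hasDerivWithinAt)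
    (fun a _ b _ hab => by simpa using hab) g
  have him : (fun x : ℝ => 2 * x) '' Ioo 0 t = Ioo 0 (2 * t) := by
    rw [Set.image_mul_left_Ioo (by norm_num)]; simp
  rw [him] at h
  rw [h]
  simp

theorem stmt10 (n : ℕ) (hn : 2 ≤ n) (α β : ℝ)
    (hα0 : 0 < α) (hαn : α < n) (hβ0 : 0 ≤ β) (hβn : β < n) (j : ℕ) :
    ∃ C : ℝ, 0 < C ∧
      ∀ f : ℝ → ℝ≥0∞, Measurable f → ∀ t : ℝ, 0 < t →
        Rop n β ((Hop n α)^[j + 1] (Pop f)) t ≤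
          ENNReal.ofReal C *
            (Rop n β ((Rop n α)^[j + 1] f) (2 * t) +
              (Hop n α)^[j + 1] (Hop n β (Pop f)) (t / 2)) := by
  obtain ⟨A, hA⟩ := iter n α hα0.le (j+1)
  obtain ⟨B, hB⟩ := Rlow n α hα0.le hαn j (1/2) (by norm_num) (by norm_num)
  refine ⟨((2 * B + 4 * A + 1 : NNReal) : ℝ), by positivity, fun f _ t ht => ?_⟩
  rw [ENNReal.ofReal_coe_nnreal]
  have h1 := hA f 0 t ht
  simp only [pow_zero, one_mul, mul_one, zero_add] at h1
  have h2 : ∫⁻ s in Ioo 0 t, wt n α s ^ (j+1) * Pop f s ≤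
      B * ∫⁻ s in Ioo 0 (2 * t), (Rop n α)^[j+1] f s := by
    rw [← lint_scale, ← lintegral_const_mul' _ _ (by simp)]
    apply setLIntegral_mono' measurableSet_Ioo
    intro u hu
    have hu0 := hu.1
    have := hB f (2*u) (by linarith)
    rw [show (1/2 : ℝ) * (2 * u) = u by ring] at this
    rw [Pop_eq f hu.1]
    calc _ ≤ wt n α (2*u) ^ (j+1) * (FF f u * ENNReal.ofReal u⁻¹) := by
          have := wt_mono n α hα0.le hu.1 (show u ≤ 2 * u by linarith)
          gcongr
      _ = 2 * (wt n α (2*u) ^ (j+1) * FF f u * ENNReal.ofReal (2*u)⁻¹) := by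
          have : ENNReal.ofReal u⁻¹ = 2 * ENNReal.ofReal (2*u)⁻¹ := by
            rw [show (2:ℝ≥0∞) = ENNReal.ofReal 2 by simp, ← ENNReal.ofReal_mul (by positivity)]
            congr 1
            field_simp
          rw [this]; ring
      _ ≤ 2 * (B * (Rop n α)^[j+1] f (2*u)) := by gcongr
      _ = _ := by ring
  have h3 : ENNReal.ofReal (phi n β t) ≤ 2 * ENNReal.ofReal (phi n β (2*t)) := by
    rw [phi_eq n β t ht, phi_eq n β (2*t) (by linarith)]
    have : ENNReal.ofReal t⁻¹ = 2 * ENNReal.ofReal (2*t)⁻¹ := by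
      rw [show (2:ℝ≥0∞) = ENNReal.ofReal 2 by simp, ← ENNReal.ofReal_mul (by positivity)]
      congr 1
      field_simp
    rw [this]
    have := wt_mono n β hβ0 ht (show t ≤ 2 * t by linarith)
    calc _ ≤ wt n β (2*t) * (2 * ENNReal.ofReal (2*t)⁻¹) := by gcongr
      _ = _ := by ring
  have h4 := absorb n α β hβ0 f (j+1) t ht
  have h5 : (Hop n α)^[j + 1] (Hop n β (Pop f)) t ≤
      (Hop n α)^[j + 1] (Hop n β (Pop f)) (t / 2) := by
    rw [Function.iterate_succ_apply']
    exact Hop_anti n α _ (by linarith)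
  have h6 := h4.trans (mul_le_mul_right h5 4)
  unfold Rop at h2 ⊢
  change _ * ∫⁻ s in Ioo 0 t, (Hop n α)^[j+1] (Pop f) s ≤
    _ * (_ * (∫⁻ s in Ioo 0 (2*t), (Rop n α)^[j+1] f s) + _)
  change _ ≤ B * (∫⁻ s in Ioo 0 (2*t), (Rop n α)^[j+1] f s) at h2
  set I := ∫⁻ s in Ioo 0 (2*t), (Rop n α)^[j+1] f s
  set K := (Hop n α)^[j + 1] (Hop n β (Pop f)) (t / 2)
  set p := ENNReal.ofReal (phi n β (2*t))
  calc _ ≤ ENNReal.ofReal (phi n β t) *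
        (B * I + A * (ENNReal.ofReal t * (Hop n α)^[j+1] (Pop f) t)) := by
        gcongr
        exact h1.trans (add_le_add_left h2 _)
    _ = ENNReal.ofReal (phi n β t) * (B * I) + A * (wt n β t * (Hop n α)^[j+1] (Pop f) t) *
        (ENNReal.ofReal t⁻¹ * ENNReal.ofReal t) := by
        rw [phi_eq n β t ht]; ring
    _ ≤ 2 * p * (B * I) + A * (4 * K) := by
        rw [ofReal_inv_cancel ht, mul_one]
        gcongr
    _ = (2 * B : NNReal) * (p * I) + (4 * A : NNReal) * K := by push_cast; ring
    _ ≤ (2 * B + 4 * A + 1 : NNReal) * (p * I) + (2 * B + 4 * A + 1 : NNReal) * K := by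
        have e1 : 2 * B ≤ 2 * B + 4 * A + 1 := by rw [add_assoc]; exact le_self_add
        have e2 : 4 * A ≤ 2 * B + 4 * A + 1 := by
          rw [add_comm (2*B), add_assoc]; exact le_self_add
        have e1' := ENNReal.coe_le_coe.2 e1
        have e2' := ENNReal.coe_le_coe.2 e2
        gcongr
    _ = _ := by ring
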